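/- arXiv:0902.2351 — 2 statements merged into one kernel-verified Lean document; each statement's English description precedes it below -/
import Mathlib

section
/- Let A and B be Banach algebras, let Θ: A → B be a bounded algebra homomorphism, and let n ∈ ℕ. If D: B → B^(2n-1) is a bounded derivation, then D₁ = Θ^(2n-1) ∘ D ∘ Θ : A → A^(2n-1) is a bounded derivation. -/
noncomputable section
set_option linter.unusedSectionVars false
universe u
open ContinuousLinearMap

variable {A B : Type u} [NonUnitalNormedRing A] [NormedSpace ℂ A] [IsScalarTower ℂ A A] [SMulCommClass ℂ A A]
  [NonUnitalNormedRing B] [NormedSpace ℂ B] [IsScalarTower ℂ B B] [SMulCommClass ℂ B B]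

/-- The "dual" action associated to a continuous action `T` of `A` on `X`:
`dualAct T a g = g ∘ (T a)`. -/
def dualAct {X : Type u} [NormedAddCommGroup X] [NormedSpace ℂ X]
    (T : A →L[ℂ] X →L[ℂ] X) : A →L[ℂ] (X →L[ℂ] ℂ) →L[ℂ] (X →L[ℂ] ℂ) :=
  (ContinuousLinearMap.compL ℂ X X ℂ).flip.comp T

@[simp] lemma dualAct_apply {X : Type u} [NormedAddCommGroup X] [NormedSpace ℂ X]
    (T : A →L[ℂ] X →L[ℂ] X) (a : A) (g : X →L[ℂ] ℂ) (x : X) :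
    dualAct T a g x = g (T a x) := rfl

/-- A Banach bimodule over a (non-unital) Banach algebra `A`: a Banach space `X`
together with commuting continuous left and right actions of `A`. -/
structure BanachBimod (A : Type u) [NonUnitalNormedRing A] [NormedSpace ℂ A]
    [IsScalarTower ℂ A A] [SMulCommClass ℂ A A] : Type (u+1) where
  X : Type u
  [grp : NormedAddCommGroup X]
  [mod : NormedSpace ℂ X]
  l : A →L[ℂ] X →L[ℂ] X
  r : A →L[ℂ] X →L[ℂ] X
  l_mul : ∀ a b x, l (a * b) x = l a (l b x)
  r_mul : ∀ a b x, r (a * b) x = r b (r a x)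
  lr : ∀ a b x, l a (r b x) = r b (l a x)

attribute [instance] BanachBimod.grp BanachBimod.mod

/-- The dual of a Banach bimodule, with actions `(a·f)(x) = f(x·a)`, `(f·a)(x) = f(a·x)`. -/
def BanachBimod.dual (M : BanachBimod A) : BanachBimod A where
  X := M.X →L[ℂ] ℂ
  l := dualAct M.r
  r := dualAct M.l
  l_mul := by intro a b f; ext x; simp [M.r_mul]
  r_mul := by intro a b f; ext x; simp [M.l_mul]
  lr := by intro a b f; ext x; simp [M.lr]

/-- The regular bimodule: `A` acting on itself by multiplication. -/
def regularBimod (A : Type u) [NonUnitalNormedRing A] [NormedSpace ℂ A]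
    [IsScalarTower ℂ A A] [SMulCommClass ℂ A A] : BanachBimod A where
  X := A
  l := ContinuousLinearMap.mul ℂ A
  r := (ContinuousLinearMap.mul ℂ A).flip
  l_mul := fun a b x => mul_assoc a b x
  r_mul := fun a b x => by simp [mul_assoc]
  lr := fun a b x => by simp [mul_assoc]

/-- The `n`-th dual `A^(n)` of `A` as a Banach `A`-bimodule (`n = 0` giving `A` itself). -/
def nthDualMod (A : Type u) [NonUnitalNormedRing A] [NormedSpace ℂ A]
    [IsScalarTower ℂ A A] [SMulCommClass ℂ A A] : ℕ → BanachBimod A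
  | 0 => regularBimod A
  | n + 1 => (nthDualMod A n).dual

/-- Pulling back a Banach `B`-bimodule along a bounded algebra homomorphism `Θ : A → B`. -/
def BanachBimod.pullback (M : BanachBimod B) (Θ : A →L[ℂ] B)
    (hΘ : ∀ a b, Θ (a * b) = Θ a * Θ b) : BanachBimod A where
  X := M.X
  l := M.l.comp Θ
  r := M.r.comp Θ
  l_mul := by intro a b x; simp [hΘ, M.l_mul]
  r_mul := by intro a b x; simp [hΘ, M.r_mul]
  lr := by intro a b x; simp [M.lr]

/-- A continuous `A`-bimodule morphism between Banach `A`-bimodules. -/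
def IsBimodHom (M N : BanachBimod A) (T : M.X →L[ℂ] N.X) : Prop :=
  (∀ a x, T (M.l a x) = N.l a (T x)) ∧ (∀ a x, T (M.r a x) = N.r a (T x))

/-- A bounded derivation from `A` into a Banach `A`-bimodule. -/
def IsDerivation (M : BanachBimod A) (D : A →L[ℂ] M.X) : Prop :=
  ∀ a b, D (a * b) = M.l a (D b) + M.r b (D a)

/-- `D` is the inner derivation implemented by `x`. -/
def IsInnerBy (M : BanachBimod A) (D : A →L[ℂ] M.X) (x : M.X) : Prop :=
  ∀ a, D a = M.l a x - M.r a x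

/-- `D` is an inner derivation. -/
def IsInner (M : BanachBimod A) (D : A →L[ℂ] M.X) : Prop :=
  ∃ x, IsInnerBy M D x

/-- `A` is `n`-weakly amenable: every bounded derivation from `A` into `A^(n)` is inner. -/
def nWeaklyAmenable (A : Type u) [NonUnitalNormedRing A] [NormedSpace ℂ A]
    [IsScalarTower ℂ A A] [SMulCommClass ℂ A A] (n : ℕ) : Prop :=
  ∀ D : A →L[ℂ] (nthDualMod A n).X, IsDerivation (nthDualMod A n) D →
    IsInner (nthDualMod A n) D

/-- The adjoint (dual map) of a continuous linear map. -/
def clmDual {X Y : Type u} [NormedAddCommGroup X] [NormedSpace ℂ X]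
    [NormedAddCommGroup Y] [NormedSpace ℂ Y] (f : X →L[ℂ] Y) :
    (Y →L[ℂ] ℂ) →L[ℂ] (X →L[ℂ] ℂ) :=
  (ContinuousLinearMap.compL ℂ X Y ℂ).flip f

@[simp] lemma clmDual_apply {X Y : Type u} [NormedAddCommGroup X] [NormedSpace ℂ X]
    [NormedAddCommGroup Y] [NormedSpace ℂ Y] (f : X →L[ℂ] Y) (g : Y →L[ℂ] ℂ) (x : X) :
    clmDual f g x = g (f x) := rfl

/-- The even iterated adjoints `Θ^(2k) : A^(2k) → B^(2k)` of a bounded map `Θ : A → B`. -/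
def evenAdj (Θ : A →L[ℂ] B) : (k : ℕ) → ((nthDualMod A (2*k)).X →L[ℂ] (nthDualMod B (2*k)).X)
  | 0 => Θ
  | k + 1 => clmDual (clmDual (evenAdj Θ k))

/-- The odd iterated adjoints `Θ^(2k+1) : B^(2k+1) → A^(2k+1)` of a bounded map `Θ : A → B`. -/
def oddAdj (Θ : A →L[ℂ] B) (k : ℕ) : ((nthDualMod B (2*k+1)).X →L[ℂ] (nthDualMod A (2*k+1)).X) :=
  clmDual (evenAdj Θ k)

theorem IsBimodHom.clmDual {M N : BanachBimod A} {T : M.X →L[ℂ] N.X} (hT : IsBimodHom M N T) :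
    IsBimodHom N.dual M.dual (_root_.clmDual T) :=
  ⟨fun a (f : N.X →L[ℂ] ℂ) => ContinuousLinearMap.ext fun x => (congrArg (⇑f) (hT.2 a x)).symm,
    fun a (f : N.X →L[ℂ] ℂ) => ContinuousLinearMap.ext fun x => (congrArg (⇑f) (hT.1 a x)).symm⟩

theorem isBimodHom_evenAdj (Θ : A →L[ℂ] B) (hΘ : ∀ a b, Θ (a * b) = Θ a * Θ b) (k : ℕ) :
    IsBimodHom (nthDualMod A (2 * k)) ((nthDualMod B (2 * k)).pullback Θ hΘ) (evenAdj Θ k) := by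
  induction k with
  | zero => exact ⟨fun a x => hΘ a x, fun a x => hΘ x a⟩
  | succ k ih => exact ih.clmDual.clmDual

theorem isBimodHom_oddAdj (Θ : A →L[ℂ] B) (hΘ : ∀ a b, Θ (a * b) = Θ a * Θ b) (k : ℕ) :
    IsBimodHom ((nthDualMod B (2 * k + 1)).pullback Θ hΘ) (nthDualMod A (2 * k + 1))
      (oddAdj Θ k) :=
  (isBimodHom_evenAdj Θ hΘ k).clmDual

theorem IsDerivation.pullback {M : BanachBimod B} {D : B →L[ℂ] M.X} (hD : IsDerivation M D)
    (Θ : A →L[ℂ] B) (hΘ : ∀ a b, Θ (a * b) = Θ a * Θ b) :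
    IsDerivation (M.pullback Θ hΘ) (D.comp Θ) :=
  fun a b => (congrArg D (hΘ a b)).trans (hD (Θ a) (Θ b))

theorem IsBimodHom.comp_isDerivation {M N : BanachBimod A} {T : M.X →L[ℂ] N.X}
    (hT : IsBimodHom M N T) {D : A →L[ℂ] M.X} (hD : IsDerivation M D) :
    IsDerivation N (T.comp D) := by
  intro a b
  simp only [ContinuousLinearMap.comp_apply]
  rw [hD a b, map_add, hT.1, hT.2]

/-- If `Θ : A → B` is a bounded algebra homomorphism between Banach algebras
and `D : B → B^(2n-1)` is a bounded derivation (here `2n-1` is encoded as `2*n+1`, `n ∈ ℕ`,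
as `n` runs over the positive naturals), then `D₁ = Θ^(2n-1) ∘ D ∘ Θ : A → A^(2n-1)` is a
bounded derivation. -/
theorem odd_pullback_derivation
    {A B : Type u} [NonUnitalNormedRing A] [NormedSpace ℂ A] [IsScalarTower ℂ A A]
    [SMulCommClass ℂ A A] [CompleteSpace A]
    [NonUnitalNormedRing B] [NormedSpace ℂ B] [IsScalarTower ℂ B B] [SMulCommClass ℂ B B]
    [CompleteSpace B]
    (Θ : A →L[ℂ] B) (hΘ : ∀ a b, Θ (a * b) = Θ a * Θ b) (n : ℕ)
    (D : B →L[ℂ] (nthDualMod B (2*n+1)).X)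
    (hD : IsDerivation (nthDualMod B (2*n+1)) D) :
    IsDerivation (nthDualMod A (2*n+1)) ((oddAdj Θ n).comp (D.comp Θ)) :=
  (isBimodHom_oddAdj Θ hΘ n).comp_isDerivation (hD.pullback Θ hΘ)
end
end

section
/- Let A and B be Banach algebras, let Θ: A → B and Φ: B → A be bounded algebra homomorphisms with Θ∘Φ = id_B, and let n ∈ ℕ. Let D: B → B^(2n-1) be a bounded derivation and set D₁ = Θ^(2n-1) ∘ D ∘ Θ : A → A^(2n-1). If D₁ is inner, implemented by F ∈ A^(2n-1), then D is inner, implemented by Φ^(2n-1)(F) ∈ B^(2n-1). -/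
noncomputable section
set_option linter.unusedSectionVars false
universe u
open ContinuousLinearMap

variable {A B : Type u} [NonUnitalNormedRing A] [NormedSpace ℂ A] [IsScalarTower ℂ A A] [SMulCommClass ℂ A A]
  [NonUnitalNormedRing B] [NormedSpace ℂ B] [IsScalarTower ℂ B B] [SMulCommClass ℂ B B]

lemma evenAdj_l (Θ : A →L[ℂ] B) (hΘ : ∀ a b, Θ (a * b) = Θ a * Θ b) (k : ℕ) :
    ∀ (a : A) (x : (nthDualMod A (2 * k)).X),
      evenAdj Θ k ((nthDualMod A (2 * k)).l a x) =
        (nthDualMod B (2 * k)).l (Θ a) (evenAdj Θ k x) := by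
  induction k with
  | zero => exact fun a x => hΘ a x
  | succ k ih =>
    intro a x
    refine ContinuousLinearMap.ext fun (g : (nthDualMod B (2 * k)).X →L[ℂ] ℂ) => ?_
    refine congrArg (DFunLike.coe (F := ((nthDualMod A (2 * k)).X →L[ℂ] ℂ) →L[ℂ] ℂ) x) ?_
    exact ContinuousLinearMap.ext fun y => congrArg g (ih a y)

lemma evenAdj_r (Θ : A →L[ℂ] B) (hΘ : ∀ a b, Θ (a * b) = Θ a * Θ b) (k : ℕ) :
    ∀ (a : A) (x : (nthDualMod A (2 * k)).X),
      evenAdj Θ k ((nthDualMod A (2 * k)).r a x) =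
        (nthDualMod B (2 * k)).r (Θ a) (evenAdj Θ k x) := by
  induction k with
  | zero => exact fun a x => hΘ x a
  | succ k ih =>
    intro a x
    refine ContinuousLinearMap.ext fun (g : (nthDualMod B (2 * k)).X →L[ℂ] ℂ) => ?_
    refine congrArg (DFunLike.coe (F := ((nthDualMod A (2 * k)).X →L[ℂ] ℂ) →L[ℂ] ℂ) x) ?_
    exact ContinuousLinearMap.ext fun y => congrArg g (ih a y)

lemma evenAdj_leftInverse (Θ : A →L[ℂ] B) (Φ : B →L[ℂ] A) (hΘΦ : ∀ b, Θ (Φ b) = b) (k : ℕ) :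
    ∀ x : (nthDualMod B (2 * k)).X, evenAdj Θ k (evenAdj Φ k x) = x := by
  induction k with
  | zero => exact hΘΦ
  | succ k ih =>
    intro x
    refine ContinuousLinearMap.ext fun (g : (nthDualMod B (2 * k)).X →L[ℂ] ℂ) => ?_
    refine congrArg (DFunLike.coe (F := ((nthDualMod B (2 * k)).X →L[ℂ] ℂ) →L[ℂ] ℂ) x) ?_
    exact ContinuousLinearMap.ext fun y => congrArg g (ih y)

lemma isInnerBy_dual_of_retract (Θ : A →L[ℂ] B) (Φ : B →L[ℂ] A) (hΘΦ : ∀ b, Θ (Φ b) = b)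
    (M : BanachBimod A) (N : BanachBimod B) (S : M.X →L[ℂ] N.X) (T : N.X →L[ℂ] M.X)
    (hST : ∀ x, S (T x) = x) (hl : ∀ b x, T (N.l b x) = M.l (Φ b) (T x))
    (hr : ∀ b x, T (N.r b x) = M.r (Φ b) (T x)) (D : B →L[ℂ] (N.X →L[ℂ] ℂ)) (F : M.X →L[ℂ] ℂ)
    (hF : IsInnerBy M.dual ((clmDual S).comp (D.comp Θ)) F) :
    IsInnerBy N.dual D (clmDual T F) := by
  intro b
  refine ContinuousLinearMap.ext fun x => ?_
  have key : D (Θ (Φ b)) (S (T x)) = F (M.r (Φ b) (T x)) - F (M.l (Φ b) (T x)) :=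
    DFunLike.congr_fun (F := M.X →L[ℂ] ℂ) (hF (Φ b)) (T x)
  rw [hΘΦ, hST, ← hl, ← hr] at key
  exact key

/-- Let `Θ : A → B` and `Φ : B → A` be bounded algebra homomorphisms with
`Θ ∘ Φ = id_B`, let `D : B → B^(2n-1)` be a bounded derivation (with `2n-1` encoded as
`2*n+1`, `n : ℕ`), and set `D₁ = Θ^(2n-1) ∘ D ∘ Θ`. If `D₁` is inner, implemented by
`F ∈ A^(2n-1)`, then `D` is inner, implemented by `Φ^(2n-1)(F)`. -/
theorem odd_inner_transfer
    {A B : Type u} [NonUnitalNormedRing A] [NormedSpace ℂ A] [IsScalarTower ℂ A A]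
    [SMulCommClass ℂ A A] [CompleteSpace A]
    [NonUnitalNormedRing B] [NormedSpace ℂ B] [IsScalarTower ℂ B B] [SMulCommClass ℂ B B]
    [CompleteSpace B]
    (Θ : A →L[ℂ] B) (hΘ : ∀ a b, Θ (a * b) = Θ a * Θ b)
    (Φ : B →L[ℂ] A) (hΦ : ∀ a b, Φ (a * b) = Φ a * Φ b)
    (hΘΦ : ∀ b, Θ (Φ b) = b) (n : ℕ)
    (D : B →L[ℂ] (nthDualMod B (2*n+1)).X)
    (hD : IsDerivation (nthDualMod B (2*n+1)) D)
    (F : (nthDualMod A (2*n+1)).X)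
    (hF : IsInnerBy (nthDualMod A (2*n+1)) ((oddAdj Θ n).comp (D.comp Θ)) F) :
    IsInnerBy (nthDualMod B (2*n+1)) D (oddAdj Φ n F) := by
  exact isInnerBy_dual_of_retract Θ Φ hΘΦ (nthDualMod A (2 * n)) (nthDualMod B (2 * n))
    (evenAdj Θ n) (evenAdj Φ n) (evenAdj_leftInverse Θ Φ hΘΦ n) (evenAdj_l Φ hΦ n)
    (evenAdj_r Φ hΦ n) D F hF
end
end
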